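/- Let μ be a Borel probability measure on [0, ∞) with μ({0}) < 1, and let φ(s) = ∫ exp(−st) dμ(t) for s ≥ 0. Let λ ≥ 0, z ∈ [0,1], and ω > 0. Then there exists exactly one x ∈ [0,1] satisfying x = z · φ(ω + λ(1 − x)). -/

import Mathlib

open MeasureTheory

/-- The Laplace–Stieltjes transform of a (probability) measure on `[0, ∞) ⊆ ℝ`. -/
noncomputable def lst (μ : Measure ℝ) (s : ℝ) : ℝ := ∫ t, Real.exp (-s * t) ∂μ

lemma exp_neg_mul_le_one {s t : ℝ} (hs : 0 ≤ s) (ht : 0 ≤ t) : Real.exp (-s * t) ≤ 1 :=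
  Real.exp_le_one_iff.2 (by nlinarith [mul_nonneg hs ht])

lemma ae_nonneg_of_measure_Iio_eq_zero {μ : Measure ℝ} (hsupp : μ (Set.Iio 0) = 0) :
    ∀ᵐ t ∂μ, 0 ≤ t := by
  simp only [ae_iff, not_le]
  exact hsupp

lemma integrable_exp_neg_mul {μ : Measure ℝ} [IsFiniteMeasure μ]
    (hμ : ∀ᵐ t ∂μ, 0 ≤ t) {s : ℝ} (hs : 0 ≤ s) :
    Integrable (fun t => Real.exp (-s * t)) μ := by
  refine Integrable.mono' (integrable_const (1 : ℝ)) (by fun_prop) ?_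
  filter_upwards [hμ] with t ht
  rw [Real.norm_eq_abs, Real.abs_exp]
  exact exp_neg_mul_le_one hs ht

lemma lst_nonneg (μ : Measure ℝ) (s : ℝ) : 0 ≤ lst μ s :=
  integral_nonneg fun _ => (Real.exp_pos _).le

lemma continuousOn_lst {μ : Measure ℝ} [IsFiniteMeasure μ] (hμ : ∀ᵐ t ∂μ, 0 ≤ t) :
    ContinuousOn (lst μ) (Set.Ici 0) := by
  refine continuousOn_of_dominated (bound := fun _ => (1 : ℝ)) (fun s _ => by fun_prop)
    (fun s hs => ?_) (integrable_const _) (.of_forall fun t => by fun_prop)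
  filter_upwards [hμ] with t ht
  rw [Real.norm_eq_abs, Real.abs_exp]
  exact exp_neg_mul_le_one hs ht

lemma convexOn_lst {μ : Measure ℝ} [IsFiniteMeasure μ] (hμ : ∀ᵐ t ∂μ, 0 ≤ t) :
    ConvexOn ℝ (Set.Ici 0) (lst μ) := by
  refine ⟨convex_Ici 0, fun x hx y hy a b ha hb hab => ?_⟩
  have hxi := (integrable_exp_neg_mul hμ hx).const_mul a
  have hyi := (integrable_exp_neg_mul hμ hy).const_mul b
  have hxy : 0 ≤ a • x + b • y := convex_Ici (0 : ℝ) hx hy ha hb hab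
  simp only [lst, smul_eq_mul] at hxy ⊢
  rw [← integral_const_mul, ← integral_const_mul, ← integral_add hxi hyi]
  refine integral_mono (integrable_exp_neg_mul hμ hxy) (hxi.add hyi) fun t => ?_
  have h := convexOn_exp.2 (Set.mem_univ (-x * t)) (Set.mem_univ (-y * t)) ha hb hab
  simp only [smul_eq_mul] at h
  convert h using 2
  ring

lemma lst_lt_one {μ : Measure ℝ} [IsProbabilityMeasure μ] (hμ : ∀ᵐ t ∂μ, 0 ≤ t)
    (h0 : μ {0} < 1) {s : ℝ} (hs : 0 < s) : lst μ s < 1 := by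
  have hint := integrable_exp_neg_mul hμ hs.le
  have hnonneg : 0 ≤ᵐ[μ] fun t => 1 - Real.exp (-s * t) := by
    filter_upwards [hμ] with t ht
    exact sub_nonneg.2 (exp_neg_mul_le_one hs.le ht)
  have hsub : ∫ t, (1 - Real.exp (-s * t)) ∂μ = 1 - lst μ s := by
    rw [integral_sub (integrable_const _) hint]
    simp [lst]
  refine lt_of_le_of_ne (sub_nonneg.1 (hsub ▸ integral_nonneg_of_ae hnonneg)) fun heq => ?_
  rw [heq, sub_self, integral_eq_zero_iff_of_nonneg_ae hnonneg
    ((integrable_const _).sub hint)] at hsub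
  refine h0.ne ((prob_compl_eq_zero_iff (measurableSet_singleton 0)).1 (ae_iff.1 ?_))
  filter_upwards [hsub] with t ht
  have hexp : Real.exp (-s * t) = 1 := (sub_eq_zero.1 ht).symm
  simpa [hs.ne'] using hexp

/-- A continuous convex function on `[0, 1]` with `0 ≤ g 0` and `g 1 < 0` has exactly one zero. -/
lemma ConvexOn.existsUnique_zero_Icc {g : ℝ → ℝ} (hg : ConvexOn ℝ (Set.Icc 0 1) g)
    (hc : ContinuousOn g (Set.Icc 0 1)) (h0 : 0 ≤ g 0) (h1 : g 1 < 0) :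
    ∃! x : ℝ, x ∈ Set.Icc (0 : ℝ) 1 ∧ g x = 0 := by
  have key : ∀ x y : ℝ, x ∈ Set.Icc (0 : ℝ) 1 → y ∈ Set.Icc (0 : ℝ) 1 →
      g x = 0 → g y = 0 → ¬ x < y := by
    intro x y hx hy hgx hgy hxy
    have hy1 : y < 1 := lt_of_le_of_ne hy.2 fun h => by rw [h] at hgy; linarith
    have hslope := hg.slope_mono_adjacent hx (Set.right_mem_Icc.2 zero_le_one) hxy hy1
    rw [hgx, hgy, sub_self, zero_div] at hslope
    exact absurd hslope (not_le.2 (div_neg_of_neg_of_pos (by linarith) (by linarith)))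
  obtain ⟨x, hx, hgx⟩ := intermediate_value_Icc' zero_le_one hc ⟨h1.le, h0⟩
  exact ⟨x, ⟨hx, hgx⟩, fun y ⟨hy, hgy⟩ => le_antisymm
    (not_lt.1 (key x y hx hy hgx hgy)) (not_lt.1 (key y x hy hx hgy hgx))⟩

/-- **Well-posedness of the busy-period fixed point.**  Let `μ` be a Borel
probability measure on `[0, ∞)` with `μ({0}) < 1` and LST `φ`.  For `λ ≥ 0`,
`z ∈ [0,1]` and `ω > 0` there is exactly one `x ∈ [0,1]` with
`x = z · φ(ω + λ(1 − x))`. -/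
theorem busy_period_fixed_point_unique
    (μ : Measure ℝ) [IsProbabilityMeasure μ]
    (hsupp : μ (Set.Iio 0) = 0) (h0 : μ {0} < 1)
    (lam : ℝ) (hlam : 0 ≤ lam)
    (z : ℝ) (hz : z ∈ Set.Icc (0 : ℝ) 1)
    (w : ℝ) (hw : 0 < w) :
    ∃! x : ℝ, x ∈ Set.Icc (0 : ℝ) 1 ∧ x = z * lst μ (w + lam * (1 - x)) := by
  have hμ := ae_nonneg_of_measure_Iio_eq_zero hsupp
  have hmem : ∀ x ∈ Set.Icc (0 : ℝ) 1, w + lam * (1 - x) ∈ Set.Ici (0 : ℝ) := fun x hx =>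
    add_nonneg hw.le (mul_nonneg hlam (sub_nonneg.2 hx.2))
  have hconv : ConvexOn ℝ (Set.Icc 0 1) fun x => z * lst μ (w + lam * (1 - x)) - x := by
    refine ⟨convex_Icc 0 1, fun x hx y hy a b ha hb hab => ?_⟩
    have h := (convexOn_lst hμ).2 (hmem x hx) (hmem y hy) ha hb hab
    have harg : w + lam * (1 - (a * x + b * y)) =
        a * (w + lam * (1 - x)) + b * (w + lam * (1 - y)) := by
      linear_combination (-w - lam) * hab
    simp only [smul_eq_mul] at h ⊢
    rw [harg]
    linarith [mul_le_mul_of_nonneg_left h hz.1]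
  have hcont : ContinuousOn (fun x => z * lst μ (w + lam * (1 - x)) - x) (Set.Icc 0 1) :=
    (((continuousOn_lst hμ).comp (by fun_prop) hmem).const_smul z).sub continuousOn_id
  have hone : z * lst μ (w + lam * (1 - 1)) - 1 < 0 := by
    have h := mul_le_of_le_one_left (lst_nonneg μ w) hz.2
    rw [sub_self, mul_zero, add_zero]
    linarith [lst_lt_one hμ h0 hw]
  have hzero : 0 ≤ z * lst μ (w + lam * (1 - 0)) - 0 := by
    rw [sub_zero (z * _)]
    exact mul_nonneg hz.1 (lst_nonneg μ _)
  have hiff : ∀ x, z * lst μ (w + lam * (1 - x)) - x = 0 ↔ x = z * lst μ (w + lam * (1 - x)) :=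
    fun x => sub_eq_zero.trans eq_comm
  simpa only [hiff] using hconv.existsUnique_zero_Icc hcont hzero hone
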